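/- Let s ∈ ℝ and n ≥ 1, and set v₀ⁿ(x) = (24/33)·2^{-n} ψ(x) and w₀ⁿ(x) = 2^{-ns} ψ(x) sin((33/24)·2ⁿ x). Then the Fourier transform of the product v₀ⁿ · ∂ₓw₀ⁿ is supported in the set {ξ : (33/24)·2ⁿ − 1 ≤ |ξ| ≤ (33/24)·2ⁿ + 1}. -/

import Mathlib

open MeasureTheory Filter Real
open scoped ENNReal

noncomputable def psi (ψhat : ℝ → ℝ) : ℝ → ℝ :=
  fun x => (1 / (2 * π)) * ∫ ξ : ℝ, ψhat ξ * Real.cos (x * ξ)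

def IsPsiHat (ψhat : ℝ → ℝ) : Prop :=
  ContDiff ℝ (⊤ : ℕ∞) ψhat ∧
  (∀ ξ, ψhat (-ξ) = ψhat ξ) ∧
  (∀ ξ, 0 ≤ ψhat ξ) ∧
  (∀ ξ, ψhat ξ ≤ 1) ∧
  (∀ ξ : ℝ, 1 / 2 < |ξ| → ψhat ξ = 0) ∧
  (∀ ξ : ℝ, |ξ| ≤ 1 / 4 → ψhat ξ = 1)

/-- The Fourier transform with convention `𝓕f(ξ) = ∫ e^{-ixξ} f(x) dx`. -/
noncomputable def ft (f : ℝ → ℝ) (ξ : ℝ) : ℂ :=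
  ∫ x : ℝ, Complex.exp (-(Complex.I * (x : ℂ) * (ξ : ℂ))) * (f x : ℂ)

/-- The high frequency function `w₀ⁿ(x) = 2^{-ns} ψ(x) sin((33/24)·2ⁿ x)`. -/
noncomputable def w0 (ψhat : ℝ → ℝ) (s : ℝ) (n : ℕ) : ℝ → ℝ :=
  fun x => (2 : ℝ) ^ (-(n : ℝ) * s) * psi ψhat x * Real.sin ((33 / 24) * 2 ^ n * x)

/-- The low frequency function `v₀ⁿ(x) = (24/33)·2^{-n} ψ(x)`. -/
noncomputable def v0 (ψhat : ℝ → ℝ) (n : ℕ) : ℝ → ℝ :=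
  fun x => (24 / 33) * (2 : ℝ) ^ (-(n : ℝ)) * psi ψhat x

open scoped FourierTransform SchwartzMap

/-- The product of two Schwartz functions whose Fourier transforms vanish outside `[-r, r]` has a
Fourier transform vanishing outside `[-2r, 2r]`. -/
lemma SchwartzMap.fourier_mul_eq_zero {F G : 𝓢(ℝ, ℂ)} {r : ℝ}
    (hF : ∀ ξ, r < |ξ| → 𝓕 F ξ = 0) (hG : ∀ ξ, r < |ξ| → 𝓕 G ξ = 0) {ξ : ℝ} (hξ : 2 * r < |ξ|) :
    𝓕 (fun x => F x * G x) ξ = 0 := by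
  have key : ∀ H : 𝓢(ℝ, ℂ), ∀ η, 𝓕⁻ H η = 𝓕 H (-η) := fun H η => by
    rw [SchwartzMap.fourierInv_coe, SchwartzMap.fourier_coe, Real.fourierInv_eq_fourier_neg]
  set B : ℂ →L[ℂ] ℂ →L[ℂ] ℂ := ContinuousLinearMap.mul ℂ ℂ with hB
  have h1 : (fun x => F x * G x) = ⇑(𝓕 (SchwartzMap.convolution B (𝓕⁻ F) (𝓕⁻ G)) : 𝓢(ℝ, ℂ)) := by
    ext x
    rw [SchwartzMap.fourier_convolution, SchwartzMap.pairing_apply_apply]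
    simp [hB]
  rw [h1, ← SchwartzMap.fourier_coe, ← neg_neg ξ, ← key, FourierTransform.fourierInv_fourier_eq,
    SchwartzMap.convolution_apply, MeasureTheory.convolution]
  refine integral_eq_zero_of_ae (Eventually.of_forall fun t => ?_)
  simp only [hB, ContinuousLinearMap.mul_apply', key, Pi.zero_apply]
  by_cases ht : r < |t|
  · rw [hF _ (by rwa [abs_neg]), zero_mul]
  · rw [hG, mul_zero]
    have := abs_sub_abs_le_abs_sub (-ξ) t
    rw [abs_neg] at this ⊢
    linarith

lemma fourier_div_two_pi_eq_integral (H : ℝ → ℂ) (η : ℝ) :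
    𝓕 H (η / (2 * π)) = ∫ x : ℝ, Complex.exp (-(Complex.I * (x : ℂ) * (η : ℂ))) * H x := by
  rw [Real.fourier_real_eq_integral_exp_smul]
  congr 1 with x
  have hpi : (π : ℂ) ≠ 0 := by exact_mod_cast Real.pi_ne_zero
  rw [smul_eq_mul]
  congr 2
  push_cast
  field_simp

lemma integrable_exp_mul {H : ℝ → ℂ} (hH : Integrable H) (η : ℝ) :
    Integrable fun x : ℝ => Complex.exp (-(Complex.I * (x : ℂ) * (η : ℂ))) * H x := by
  refine hH.bdd_mul (c := 1) (by fun_prop) (Eventually.of_forall fun x => ?_)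
  rw [Complex.norm_exp]
  simp

/-- Modulating by `cos (l x)` and `sin (l x)` shifts the spectrum by `± l`. -/
lemma integral_exp_mul_modulation_eq_zero {P Q : ℝ → ℂ} (hP : Integrable P) (hQ : Integrable Q)
    {l ξ : ℝ} (a b : ℂ)
    (hP1 : 𝓕 P ((ξ - l) / (2 * π)) = 0) (hP2 : 𝓕 P ((ξ + l) / (2 * π)) = 0)
    (hQ1 : 𝓕 Q ((ξ - l) / (2 * π)) = 0) (hQ2 : 𝓕 Q ((ξ + l) / (2 * π)) = 0) :
    ∫ x : ℝ, Complex.exp (-(Complex.I * (x : ℂ) * (ξ : ℂ))) *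
      (a * (Q x * Complex.sin (l * x)) + b * (P x * Complex.cos (l * x))) = 0 := by
  rw [fourier_div_two_pi_eq_integral] at hP1 hP2 hQ1 hQ2
  have iP1 := integrable_exp_mul hP (ξ - l)
  have iP2 := integrable_exp_mul hP (ξ + l)
  have iQ1 := integrable_exp_mul hQ (ξ - l)
  have iQ2 := integrable_exp_mul hQ (ξ + l)
  have e : ∀ x : ℝ, Complex.exp (-(Complex.I * (x : ℂ) * (ξ : ℂ))) *
      (a * (Q x * Complex.sin (l * x)) + b * (P x * Complex.cos (l * x))) =
      ((a * Complex.I / 2) * (Complex.exp (-(Complex.I * (x : ℂ) * ((ξ + l : ℝ) : ℂ))) * Q x) +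
       (-(a * Complex.I / 2)) * (Complex.exp (-(Complex.I * (x : ℂ) * ((ξ - l : ℝ) : ℂ))) * Q x)) +
      ((b / 2) * (Complex.exp (-(Complex.I * (x : ℂ) * ((ξ + l : ℝ) : ℂ))) * P x) +
       (b / 2) * (Complex.exp (-(Complex.I * (x : ℂ) * ((ξ - l : ℝ) : ℂ))) * P x)) := by
    intro x
    have e1 : Complex.exp (-(Complex.I * (x : ℂ) * ((ξ + l : ℝ) : ℂ))) =
        Complex.exp (-(Complex.I * (x : ℂ) * (ξ : ℂ))) * Complex.exp (-(l * x) * Complex.I) := by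
      rw [← Complex.exp_add]; congr 1; push_cast; ring
    have e2 : Complex.exp (-(Complex.I * (x : ℂ) * ((ξ - l : ℝ) : ℂ))) =
        Complex.exp (-(Complex.I * (x : ℂ) * (ξ : ℂ))) * Complex.exp (l * x * Complex.I) := by
      rw [← Complex.exp_add]; congr 1; push_cast; ring
    rw [e1, e2, Complex.sin, Complex.cos]
    ring
  simp_rw [e]
  rw [integral_add ((iQ2.const_mul _).fun_add (iQ1.const_mul _))
      ((iP2.const_mul _).fun_add (iP1.const_mul _)),
    integral_add (iQ2.const_mul _) (iQ1.const_mul _),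
    integral_add (iP2.const_mul _) (iP1.const_mul _)]
  simp only [integral_const_mul, hP1, hP2, hQ1, hQ2, mul_zero, add_zero]

lemma integral_mul_cexp_of_even {f : ℝ → ℝ} (hf : Integrable f) (heven : ∀ t, f (-t) = f t)
    (x : ℝ) :
    ∫ t : ℝ, (f t : ℂ) * Complex.exp ((x * t : ℝ) * Complex.I) =
      ((∫ t : ℝ, f t * Real.cos (x * t) : ℝ) : ℂ) := by
  have hc : Integrable fun t => f t * Real.cos (x * t) :=
    hf.mul_bdd (c := 1) (by fun_prop) (Eventually.of_forall fun t => Real.abs_cos_le_one _)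
  have hs : Integrable fun t => f t * Real.sin (x * t) :=
    hf.mul_bdd (c := 1) (by fun_prop) (Eventually.of_forall fun t => Real.abs_sin_le_one _)
  have hodd : ∫ t : ℝ, f t * Real.sin (x * t) = 0 := by
    have h1 := integral_neg_eq_self (fun t : ℝ => f t * Real.sin (x * t)) volume
    simp only [heven, mul_neg, Real.sin_neg, integral_neg] at h1
    linarith
  have e : ∀ t : ℝ, (f t : ℂ) * Complex.exp ((x * t : ℝ) * Complex.I) =
      ((f t * Real.cos (x * t) : ℝ) : ℂ) + ((f t * Real.sin (x * t) : ℝ) : ℂ) * Complex.I := by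
    intro t
    rw [Complex.exp_mul_I]
    push_cast
    ring
  simp_rw [e]
  rw [integral_add hc.ofReal (hs.ofReal.mul_const _), integral_mul_const, integral_complex_ofReal,
    integral_complex_ofReal, hodd]
  simp

/-- `ψ` is a Schwartz function whose Fourier transform is supported where `|2πη| ≤ 1/2`. -/
lemma IsPsiHat.exists_schwartzMap {ψhat : ℝ → ℝ} (h : IsPsiHat ψhat) :
    ∃ Ψ : 𝓢(ℝ, ℂ), (∀ x, Ψ x = (psi ψhat x : ℂ)) ∧
      ∀ η, 1 / (4 * π) < |η| → 𝓕 Ψ η = 0 := by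
  obtain ⟨hsm, heven, -, -, hsupp, -⟩ := h
  have hpi := Real.pi_pos
  have hcs : HasCompactSupport ψhat :=
    HasCompactSupport.intro (isCompact_Icc (a := -(1 / 2 : ℝ)) (b := 1 / 2)) fun x hx => by
      refine hsupp x ?_
      by_contra hcon
      exact hx (abs_le.1 (not_lt.1 hcon))
  have hint : Integrable ψhat := hsm.continuous.integrable_of_hasCompactSupport hcs
  set g : ℝ → ℂ := fun η => (ψhat (2 * π * η) : ℂ) with hg
  have hgsupp : ∀ η, 1 / (4 * π) < |η| → g η = 0 := by
    intro η hη
    have : ψhat (2 * π * η) = 0 := by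
      refine hsupp _ ?_
      rw [abs_mul, abs_of_pos (by positivity)]
      rw [div_lt_iff₀ (by positivity)] at hη
      linarith
    simp [hg, this]
  have hgs : ContDiff ℝ (⊤ : ℕ∞) g :=
    Complex.ofRealCLM.contDiff.comp (hsm.comp (contDiff_const.mul contDiff_id))
  have hgc : HasCompactSupport g :=
    HasCompactSupport.intro (isCompact_Icc (a := -(1 / (4 * π))) (b := 1 / (4 * π)))
      fun x hx => by
        refine hgsupp x ?_
        by_contra hcon
        exact hx (abs_le.1 (not_lt.1 hcon))
  set φ : 𝓢(ℝ, ℂ) := hgc.toSchwartzMap hgs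
  have hφg : ⇑φ = g := rfl
  refine ⟨𝓕⁻ φ, fun x => ?_, fun η hη => ?_⟩
  · rw [SchwartzMap.fourierInv_coe, Real.fourierInv_eq_fourier_neg,
      Real.fourier_real_eq_integral_exp_smul, hφg]
    have e : ∀ v : ℝ, Complex.exp (↑(-2 * π * v * -x) * Complex.I) • g v =
        (fun t : ℝ => (ψhat t : ℂ) * Complex.exp ((x * t : ℝ) * Complex.I)) (2 * π * v) := by
      intro v
      rw [smul_eq_mul, mul_comm]
      simp only [hg]
      congr 3
      push_cast
      ring
    simp_rw [e]
    rw [Measure.integral_comp_mul_left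
      (fun t : ℝ => (ψhat t : ℂ) * Complex.exp ((x * t : ℝ) * Complex.I)),
      integral_mul_cexp_of_even hint heven, psi, abs_of_pos (by positivity)]
    simp
  · rw [FourierTransform.fourier_fourierInv_eq, hφg]
    exact hgsupp η hη

/-- The Fourier transform of `v₀ⁿ · ∂ₓw₀ⁿ` is supported in
`{ξ : (33/24)·2ⁿ − 1 ≤ |ξ| ≤ (33/24)·2ⁿ + 1}`. -/
theorem support_ft_v0_dx_w0 (ψhat : ℝ → ℝ) (h : IsPsiHat ψhat)
    (s : ℝ) (n : ℕ) (hn : 1 ≤ n) :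
    Function.support (ft (fun x => v0 ψhat n x * deriv (w0 ψhat s n) x)) ⊆
      {ξ : ℝ | (33 / 24) * 2 ^ n - 1 ≤ |ξ| ∧ |ξ| ≤ (33 / 24) * 2 ^ n + 1} := by
  obtain ⟨Ψ, hΨ, hF⟩ := h.exists_schwartzMap
  have hpi := Real.pi_pos
  set l : ℝ := (33 / 24) * 2 ^ n with hl
  have hl0 : 0 ≤ l := by positivity
  set D : 𝓢(ℝ, ℂ) := SchwartzMap.derivCLM ℂ ℂ Ψ
  have hDΨ : ∀ x, D x = deriv Ψ x := fun x => SchwartzMap.derivCLM_apply ℂ Ψ x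
  have hFD : ∀ η, 1 / (4 * π) < |η| → 𝓕 D η = 0 := by
    intro η hη
    have hDf : ⇑D = deriv Ψ := funext hDΨ
    rw [SchwartzMap.fourier_coe, hDf,
      Real.fourier_deriv Ψ.integrable Ψ.differentiable (hDf ▸ D.integrable),
      ← SchwartzMap.fourier_coe]
    simp [hF η hη]
  have hderiv : ∀ x, HasDerivAt (psi ψhat) (D x).re x := by
    intro x
    have h1 : HasDerivAt Ψ (D x) x := hDΨ x ▸ (Ψ.differentiable x).hasDerivAt
    have h2 := Complex.reCLM.hasFDerivAt.comp_hasDerivAt x h1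
    refine h2.congr_of_eventuallyEq (Eventually.of_forall fun y => ?_)
    simp [hΨ]
  have hDre : ∀ x, D x = ((D x).re : ℂ) := by
    intro x
    have h1 := (hderiv x).ofReal_comp
    rw [← h1.deriv, hDΨ]
    congr 1
    exact funext hΨ
  intro ξ hξ
  by_contra hcon
  apply hξ
  have hfar : 1 < |ξ - l| ∧ 1 < |ξ + l| := by
    have h1 := abs_sub_abs_le_abs_sub ξ l
    have h2 := abs_sub_abs_le_abs_sub l ξ
    have h3 := abs_sub_abs_le_abs_sub ξ (-l)
    have h4 := abs_sub_abs_le_abs_sub (-l) ξ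
    rw [abs_sub_comm] at h2 h4
    rw [sub_neg_eq_add, abs_neg] at h3 h4
    rw [abs_of_nonneg hl0] at h1 h2 h3 h4
    rw [Set.mem_ofPred_eq, not_and_or, not_le, not_le] at hcon
    rcases hcon with hc | hc <;> constructor <;> linarith
  have hscale : ∀ η : ℝ, 1 < |η| → 2 * (1 / (4 * π)) < |η / (2 * π)| := by
    intro η hη
    rw [abs_div, abs_of_pos (show 0 < 2 * π by positivity), lt_div_iff₀ (by positivity)]
    field_simp
    linarith
  have hmul : ∀ F G : 𝓢(ℝ, ℂ), Integrable fun x => F x * G x := fun F G =>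
    (SchwartzMap.pairing (ContinuousLinearMap.mul ℂ ℂ) F G).integrable
  set A : ℝ := (24 / 33) * (2 : ℝ) ^ (-(n : ℝ))
  set C : ℝ := (2 : ℝ) ^ (-(n : ℝ) * s)
  have key := integral_exp_mul_modulation_eq_zero (hmul Ψ Ψ) (hmul Ψ D) (l := l) (ξ := ξ)
    ((A * C : ℝ) : ℂ) ((A * C * l : ℝ) : ℂ)
    (SchwartzMap.fourier_mul_eq_zero hF hF (hscale _ hfar.1))
    (SchwartzMap.fourier_mul_eq_zero hF hF (hscale _ hfar.2))
    (SchwartzMap.fourier_mul_eq_zero hF hFD (hscale _ hfar.1))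
    (SchwartzMap.fourier_mul_eq_zero hF hFD (hscale _ hfar.2))
  rw [ft, ← key]
  congr 1 with x
  congr 1
  have hw : HasDerivAt (w0 ψhat s n)
      (C * (D x).re * Real.sin (l * x) + C * psi ψhat x * (Real.cos (l * x) * l)) x := by
    have hlin : HasDerivAt (fun y : ℝ => l * y) l x := by
      simpa using (hasDerivAt_id x).const_mul l
    exact ((hderiv x).const_mul C).mul hlin.sin
  have hv : v0 ψhat n x = A * psi ψhat x := rfl
  rw [hw.deriv, hv, hΨ, hDre, Complex.ofReal_re]
  push_cast
  ring
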